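/- The decomposition coproduct Γ on the free vector space over Ω*, defined by Γ(w) = Σ_{s≥1} Σ_{w = w¹.⋯.wˢ} ‖w¹‖⋯‖wˢ‖ ⊗ (w¹ ⧢ ⋯ ⧢ wˢ) (sum over decompositions into nonempty words), is coassociative. -/

import Mathlib

/-- The quasi-shuffle product of two words over a commutative semigroup `Ω`. -/
noncomputable def qsh {Ω : Type*} [AddCommSemigroup Ω] :
    List Ω → List Ω → (List Ω →₀ ℤ)
  | [], w => Finsupp.single w 1
  | a :: w', [] => Finsupp.single (a :: w') 1
  | a :: w', b :: w'' =>
      Finsupp.mapDomain (a :: ·) (qsh w' (b :: w''))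
    + Finsupp.mapDomain (b :: ·) (qsh (a :: w') w'')
    + Finsupp.mapDomain ((a + b) :: ·) (qsh w' w'')
  termination_by w₁ w₂ => w₁.length + w₂.length

/-- Weight of a word (junk default value for the empty word). -/
def wt {Ω : Type*} [AddCommSemigroup Ω] [Inhabited Ω] : List Ω → Ω
  | [] => default
  | a :: l => l.foldl (· + ·) a

/-- Iterated quasi-shuffle `w¹ ⧢ ⋯ ⧢ wˢ` of a list of words. -/
noncomputable def qshFold {Ω : Type*} [AddCommSemigroup Ω] :
    List (List Ω) → (List Ω →₀ ℤ)
  | [] => Finsupp.single [] 1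
  | u :: rest => (qshFold rest).sum fun v c => c • qsh u v

/-- The decomposition coproduct
`Γ(w) = ∑_{s≥1} ∑_{w = w¹.⋯.wˢ} ‖w¹‖⋯‖wˢ‖ ⊗ (w¹ ⧢ ⋯ ⧢ wˢ)`, the sum running
over decompositions of `w` into nonempty words; the tensor square of the free
module on words is modelled as the free module on pairs of words. -/
noncomputable def Gam {Ω : Type*} [AddCommSemigroup Ω] [Inhabited Ω]
    (w : List Ω) : (List Ω × List Ω) →₀ ℤ :=
  ∑ c : Composition w.length,
    Finsupp.mapDomain (fun v => ((w.splitWrtComposition c).map wt, v))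
      (qshFold (w.splitWrtComposition c))


/-- The free `R`-module on words over `Ω`, with the quasi-shuffle product. -/
def QSh (R Ω : Type*) [CommRing R] : Type _ := List Ω →₀ R

namespace QSh

section Basic

variable {R Ω : Type*} [CommRing R]

noncomputable instance : AddCommGroup (QSh R Ω) := inferInstanceAs (AddCommGroup (List Ω →₀ R))

noncomputable instance : Module R (QSh R Ω) := inferInstanceAs (Module R (List Ω →₀ R))

/-- The basis vector attached to a word. -/
noncomputable def of (w : List Ω) : QSh R Ω := Finsupp.single w (1 : R)

lemma smul_of (r : R) (w : List Ω) : (r • of w : QSh R Ω) = Finsupp.single w r :=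
  (Finsupp.smul_single r w (1 : R)).trans (by simp)

noncomputable instance : One (QSh R Ω) := ⟨of []⟩

lemma one_def : (1 : QSh R Ω) = of [] := rfl

/-- Prepend a letter to every word. -/
noncomputable def cons (a : Ω) : QSh R Ω →ₗ[R] QSh R Ω :=
  Finsupp.lmapDomain R R (a :: ·)

@[simp] lemma cons_of (a : Ω) (w : List Ω) : cons a (of w : QSh R Ω) = of (a :: w) :=
  Finsupp.mapDomain_single

@[elab_as_elim]
lemma induction_on {P : QSh R Ω → Prop} (x : QSh R Ω) (zero : P 0)
    (add : ∀ x y, P x → P y → P (x + y)) (smul : ∀ (r : R) w, P (r • of w)) : P x :=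
  Finsupp.induction_linear (motive := P) x zero add fun w r => smul_of r w ▸ smul r w

/-- The `R`-linear extension of a function on words. -/
noncomputable def lift {M : Type*} [AddCommGroup M] [Module R M] (f : List Ω → M) :
    QSh R Ω →ₗ[R] M :=
  Finsupp.linearCombination R f

@[simp] lemma lift_of {M : Type*} [AddCommGroup M] [Module R M] (f : List Ω → M) (w : List Ω) :
    lift f (of w : QSh R Ω) = f w :=
  (Finsupp.linearCombination_single R 1 w).trans (one_smul R _)

/-- The additive extension of a family of additive maps indexed by words. -/
noncomputable def addLift {M : Type*} [AddCommGroup M] (f : List Ω → R →+ M) :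
    QSh R Ω →+ M :=
  Finsupp.liftAddHom f

@[simp] lemma addLift_smul_of {M : Type*} [AddCommGroup M] (f : List Ω → R →+ M) (r : R)
    (w : List Ω) : addLift f (r • of w) = f w r := by
  rw [smul_of]
  exact Finsupp.liftAddHom_apply_single f w r

lemma addHom_ext {M : Type*} [AddCommGroup M] {f g : QSh R Ω →+ M}
    (h : ∀ (r : R) w, f (r • of w) = g (r • of w)) : f = g := by
  ext x
  induction x using induction_on with
  | zero => simp
  | add x y hx hy => simp [hx, hy]
  | smul r w => exact h r w

lemma int_addHom_ext {M : Type*} [AddCommGroup M] {f g : QSh ℤ Ω →+ M}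
    (h : ∀ w, f (of w) = g (of w)) : f = g := by
  refine Finsupp.addHom_ext' fun w => AddMonoidHom.ext_int ?_
  exact h w

/-- Extension of scalars from the integers. -/
noncomputable def baseChange : QSh ℤ Ω →+ QSh R Ω :=
  Finsupp.mapRange.addMonoidHom (Int.castAddHom R)

@[simp] lemma baseChange_of (w : List Ω) : baseChange (of w : QSh ℤ Ω) = (of w : QSh R Ω) :=
  (Finsupp.mapRange_single (hf := by simp)).trans (by simp [of])

lemma baseChange_int (x : QSh ℤ Ω) : baseChange x = x :=
  DFunLike.congr_fun (int_addHom_ext (f := baseChange) (g := AddMonoidHom.id (QSh ℤ Ω))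
    fun w => by simp) x

lemma baseChange_cons (a : Ω) (x : QSh ℤ Ω) :
    baseChange (cons a x) = cons a (baseChange x : QSh R Ω) := by
  refine DFunLike.congr_fun (int_addHom_ext (f := baseChange.comp (cons a).toAddMonoidHom)
    (g := (cons a).toAddMonoidHom.comp baseChange) fun w => ?_) x
  simp

end Basic

section Mul

variable {R Ω : Type*} [CommRing R] [AddCommSemigroup Ω]

/-- The quasi-shuffle product of two words, as an element of `QSh ℤ Ω`. -/
noncomputable def shuffle (u v : List Ω) : QSh ℤ Ω := qsh u v

lemma shuffle_nil_left (v : List Ω) : shuffle [] v = of v := by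
  unfold shuffle
  rw [qsh]
  rfl

lemma shuffle_nil_right (u : List Ω) : shuffle u [] = of u := by
  unfold shuffle
  cases u <;> rw [qsh] <;> rfl

lemma shuffle_cons_cons (a b : Ω) (u v : List Ω) :
    shuffle (a :: u) (b :: v) = cons a (shuffle u (b :: v)) + cons b (shuffle (a :: u) v) +
      cons (a + b) (shuffle u v) := by
  unfold shuffle
  rw [qsh]
  rfl

/-- The quasi-shuffle product as a bilinear map. -/
noncomputable def mulHom : QSh R Ω →ₗ[R] QSh R Ω →ₗ[R] QSh R Ω :=
  lift fun u => lift fun v => baseChange (shuffle u v)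

noncomputable instance : Mul (QSh R Ω) := ⟨fun x y => mulHom x y⟩

lemma mul_def (x y : QSh R Ω) : x * y = mulHom x y := rfl

lemma of_mul_of (u v : List Ω) :
    (of u * of v : QSh R Ω) = baseChange (shuffle u v) := by
  simp [mul_def, mulHom]

private lemma add_mul' (x y z : QSh R Ω) : (x + y) * z = x * z + y * z := by
  simp [mul_def]

private lemma mul_add' (x y z : QSh R Ω) : x * (y + z) = x * y + x * z := by
  simp [mul_def]

private lemma smul_mul' (r : R) (x y : QSh R Ω) : (r • x) * y = r • (x * y) := by
  simp [mul_def]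

private lemma mul_smul' (r : R) (x y : QSh R Ω) : x * (r • y) = r • (x * y) := by
  simp [mul_def]

private lemma zero_mul' (x : QSh R Ω) : 0 * x = 0 := by
  simp [mul_def]

private lemma mul_zero' (x : QSh R Ω) : x * 0 = 0 := by
  simp [mul_def]

private lemma one_mul' (x : QSh R Ω) : 1 * x = x := by
  induction x using induction_on with
  | zero => exact mul_zero' _
  | add x y hx hy => rw [mul_add', hx, hy]
  | smul r w =>
    rw [mul_smul', one_def, of_mul_of, shuffle_nil_left, baseChange_of]

private lemma of_cons_mul_of_cons (a b : Ω) (u v : List Ω) :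
    (of (a :: u) * of (b :: v) : QSh R Ω) = cons a (of u * of (b :: v)) +
      cons b (of (a :: u) * of v) + cons (a + b) (of u * of v) := by
  simp only [of_mul_of, ← baseChange_cons, ← map_add, shuffle_cons_cons]

lemma cons_mul_cons (a b : Ω) (x y : QSh R Ω) :
    cons a x * cons b y =
      cons a (x * cons b y) + cons b (cons a x * y) + cons (a + b) (x * y) := by
  induction x using induction_on with
  | zero => simp [zero_mul']
  | add x x' hx hx' => simp only [map_add, add_mul', hx, hx']; abel
  | smul r u =>
    induction y using induction_on with
    | zero => simp [mul_zero']
    | add y y' hy hy' => simp only [map_add, mul_add', hy, hy']; abel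
    | smul s v =>
      simp only [map_smul, smul_mul', mul_smul', cons_of, of_cons_mul_of_cons, smul_add]

private lemma of_mul_comm (u v : List Ω) : (of u * of v : QSh R Ω) = of v * of u := by
  induction u generalizing v with
  | nil => simp only [of_mul_of, shuffle_nil_left, shuffle_nil_right]
  | cons a u ihu =>
    induction v with
    | nil => simp only [of_mul_of, shuffle_nil_left, shuffle_nil_right]
    | cons b v ihv =>
      rw [of_cons_mul_of_cons, of_cons_mul_of_cons, ihu, ihu, ihv, add_comm a b]
      abel

private lemma mul_comm' (x y : QSh R Ω) : x * y = y * x := by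
  induction x using induction_on with
  | zero => rw [zero_mul', mul_zero']
  | add x x' hx hx' => rw [add_mul', mul_add', hx, hx']
  | smul r u =>
    induction y using induction_on with
    | zero => rw [zero_mul', mul_zero']
    | add x x' hx hx' => rw [add_mul', mul_add', hx, hx']
    | smul s v => rw [smul_mul', mul_smul', smul_mul', mul_smul', of_mul_comm, smul_comm]

private lemma of_mul_assoc (u v w : List Ω) :
    (of u * of v * of w : QSh R Ω) = of u * (of v * of w) := by
  induction u generalizing v w with
  | nil => rw [← one_def, one_mul', one_mul']
  | cons a u ihu =>
    induction v generalizing w with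
    | nil => rw [← one_def, mul_comm' _ 1, one_mul', one_mul']
    | cons b v ihv =>
      induction w with
      | nil => rw [← one_def, mul_comm' _ 1, one_mul', mul_comm' _ 1, one_mul']
      | cons c w ihw =>
        have h₁ := congrArg (cons a) (ihu (b :: v) (c :: w))
        have h₂ := congrArg (cons (a + c)) (ihu (b :: v) w)
        have h₃ := congrArg (cons (a + b)) (ihu v (c :: w))
        have h₄ := congrArg (cons (a + b + c)) (ihu v w)
        have h₅ := congrArg (cons b) (ihv (c :: w))
        have h₆ := congrArg (cons (b + c)) (ihv w)
        have h₇ := congrArg (cons c) ihw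
        simp only [← cons_of, cons_mul_cons, add_mul', mul_add', map_add, ← add_assoc a b c] at *
        rw [add_right_comm a b c] at *
        linear_combination (norm := skip) h₁ + h₂ + h₃ + h₄ + h₅ + h₆ + h₇
        abel

private lemma mul_assoc' (x y z : QSh R Ω) : x * y * z = x * (y * z) := by
  induction x using induction_on with
  | zero => simp only [zero_mul']
  | add x x' hx hx' => simp only [add_mul', hx, hx']
  | smul r u =>
    induction y using induction_on with
    | zero => simp only [zero_mul', mul_zero']
    | add x x' hx hx' => simp only [add_mul', mul_add', hx, hx']
    | smul s v =>
      induction z using induction_on with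
      | zero => simp only [mul_zero']
      | add x x' hx hx' => simp only [mul_add', hx, hx']
      | smul t w => simp only [smul_mul', mul_smul', of_mul_assoc]

noncomputable instance : CommRing (QSh R Ω) :=
  { (inferInstance : AddCommGroup (QSh R Ω)) with
    mul := (· * ·)
    one := 1
    left_distrib := mul_add'
    right_distrib := add_mul'
    zero_mul := zero_mul'
    mul_zero := mul_zero'
    mul_assoc := mul_assoc'
    one_mul := one_mul'
    mul_one := fun x => (mul_comm' x 1).trans (one_mul' x)
    mul_comm := mul_comm' }

noncomputable instance : Algebra R (QSh R Ω) := Algebra.ofModule smul_mul' mul_smul'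

/-- Extension of scalars from the integers, as a ring homomorphism. -/
noncomputable def baseChangeRingHom : QSh ℤ Ω →+* QSh R Ω :=
  { baseChange with
    map_one' := baseChange_of []
    map_zero' := map_zero baseChange
    map_mul' := by
      intro x y
      change baseChange (x * y) = baseChange x * baseChange y
      suffices h : (baseChange (R := R)).comp (AddMonoidHom.mulLeft x) =
          (AddMonoidHom.mulLeft (baseChange x)).comp baseChange from DFunLike.congr_fun h y
      refine int_addHom_ext fun v => ?_
      suffices h : (baseChange (R := R)).comp (AddMonoidHom.mulRight (of v)) =
          (AddMonoidHom.mulRight (of v)).comp baseChange by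
        simpa using DFunLike.congr_fun h x
      refine int_addHom_ext fun u => ?_
      simp only [AddMonoidHom.comp_apply, AddMonoidHom.mulRight_apply, baseChange_of, of_mul_of,
        baseChange_int] }

end Mul
end QSh

section WordSums

variable {α M N : Type*} [AddCommMonoid M] [AddCommMonoid N]

/-- The sum of `F u v` over all ways of writing `w = u ++ v`. -/
def splitSum (F : List α → List α → M) (w : List α) : M :=
  ∑ i ∈ Finset.range (w.length + 1), F (w.take i) (w.drop i)

lemma splitSum_nil (F : List α → List α → M) : splitSum F [] = F [] [] := by
  simp [splitSum]

lemma splitSum_cons (F : List α → List α → M) (a : α) (w : List α) :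
    splitSum F (a :: w) = F [] (a :: w) + splitSum (fun u v => F (a :: u) v) w := by
  rw [splitSum, Finset.sum_range_succ', add_comm]
  simp [splitSum]

lemma splitSum_add (F G : List α → List α → M) (w : List α) :
    splitSum (fun u v => F u v + G u v) w = splitSum F w + splitSum G w :=
  Finset.sum_add_distrib

lemma map_splitSum (h : M →+ N) (F : List α → List α → M) (w : List α) :
    h (splitSum F w) = splitSum (fun u v => h (F u v)) w :=
  map_sum h _ _

/-- The list of all decompositions of a word into nonempty words. -/
def decompositions : List α → List (List (List α))
  | [] => [[]]
  | a :: w => (decompositions w).flatMap fun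
    | [] => [[[a]]]
    | b :: L => [[a] :: b :: L, (a :: b) :: L]

lemma mem_decompositions {w : List α} {L : List (List α)} :
    L ∈ decompositions w ↔ L.flatten = w ∧ [] ∉ L := by
  induction w generalizing L with
  | nil =>
    cases L with
    | nil => simp [decompositions]
    | cons b L => cases b <;> simp [decompositions]
  | cons a w ih =>
    simp only [decompositions, List.mem_flatMap, ih]
    constructor
    · rintro ⟨_ | ⟨b, L'⟩, ⟨rfl, h⟩, hL⟩
      · simp_all
      · simp only [List.mem_cons, List.not_mem_nil, or_false] at hL
        obtain rfl | rfl := hL <;> simp_all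
    · rintro ⟨h₁, h₂⟩
      obtain _ | ⟨_ | ⟨c, b⟩, L⟩ := L
      · simp at h₁
      · simp at h₂
      · simp only [List.flatten_cons, List.cons_append, List.cons.injEq] at h₁
        obtain ⟨rfl, rfl⟩ := h₁
        cases b with
        | nil =>
          refine ⟨L, ⟨by simp, by simp_all⟩, ?_⟩
          cases L <;> simp
        | cons d b => exact ⟨(d :: b) :: L, ⟨by simp, by simp_all⟩, by simp⟩

lemma nodup_decompositions (w : List α) : (decompositions w).Nodup := by
  induction w with
  | nil => simp [decompositions]
  | cons a w ih =>
    rw [decompositions, List.nodup_flatMap]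
    constructor
    · rintro (_ | ⟨b, L⟩) hL
      · simp
      · have := (mem_decompositions.1 hL).2
        simp_all [eq_comm]
    · refine List.Nodup.pairwise_of_forall_ne ih fun L hL L' hL' hne => ?_
      have h := (mem_decompositions.1 hL).2
      have h' := (mem_decompositions.1 hL').2
      obtain _ | ⟨b, L⟩ := L <;> obtain _ | ⟨b', L'⟩ := L' <;>
        simp_all [List.disjoint_left, Function.onFun]

/-- The sum of `f L` over all decompositions `L` of `w` into nonempty words. -/
def decSum (f : List (List α) → M) (w : List α) : M :=
  ((decompositions w).map f).sum

/-- The value of `f` after adding a letter to the first word of a list of words. -/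
def glue (a : α) (f : List (List α) → M) : List (List α) → M
  | [] => 0
  | b :: L => f ((a :: b) :: L)

lemma decSum_nil (f : List (List α) → M) : decSum f [] = f [] := by
  simp [decSum, decompositions]

lemma decSum_cons (f : List (List α) → M) (a : α) (w : List α) :
    decSum f (a :: w) = decSum (fun L => f ([a] :: L) + glue a f L) w := by
  rw [decSum, decSum, decompositions]
  induction decompositions w with
  | nil => rfl
  | cons L Ls ih =>
    simp only [List.flatMap_cons, List.map_append, List.sum_append, List.map_cons, List.sum_cons, ih]
    cases L <;> simp [glue]

lemma decSum_congr {f g : List (List α) → M} {w : List α}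
    (h : ∀ L, [] ∉ L → L.flatten = w → f L = g L) : decSum f w = decSum g w := by
  refine congrArg List.sum (List.map_congr_left fun L hL => ?_)
  exact h L (mem_decompositions.1 hL).2 (mem_decompositions.1 hL).1

lemma decSum_add (f g : List (List α) → M) (w : List α) :
    decSum (fun L => f L + g L) w = decSum f w + decSum g w :=
  List.sum_map_add

lemma map_decSum (h : M →+ N) (f : List (List α) → M) (w : List α) :
    h (decSum f w) = decSum (fun L => h (f L)) w := by
  simp [decSum, map_list_sum, Function.comp_def]

lemma decSum_cons_eq_splitSum (f : List (List α) → M) (a : α) (w : List α) :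
    decSum f (a :: w) = splitSum (fun u v => decSum (fun L => f ((a :: u) :: L)) v) w := by
  induction w generalizing a f with
  | nil => simp [decSum_cons, decSum_nil, splitSum_nil, glue]
  | cons b w ih => rw [decSum_cons, decSum_add, splitSum_cons, ih (glue a f) b]; rfl

lemma decSum_splitSum (F : List (List α) → List (List α) → M) (w : List α) :
    decSum (splitSum F) w =
      splitSum (fun u v => decSum (fun L => decSum (F L) v) u) w := by
  induction w generalizing F with
  | nil => simp [decSum_nil, splitSum_nil]
  | cons a w ih =>
    have h : (fun L => splitSum F ([a] :: L) + glue a (splitSum F) L) = fun L =>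
        (F [] ([a] :: L) + glue a (F []) L) +
          splitSum (fun L₁ L₂ => F ([a] :: L₁) L₂ + glue a (fun L => F L L₂) L₁) L := by
      funext L
      rw [splitSum_add, splitSum_cons]
      cases L with
      | nil => simp [glue, splitSum_nil]
      | cons b L =>
        simp only [glue, splitSum_cons]
        abel
    rw [decSum_cons, h, decSum_add, ← decSum_cons, ih, splitSum_cons, decSum_nil]
    congr 2
    funext u v
    rw [decSum_cons]
    congr 1
    funext L
    rw [decSum_add]
    cases L <;> simp [glue, decSum]

lemma sum_composition (f : List (List α) → M) (w : List α) :
    ∑ c : Composition w.length, f (w.splitWrtComposition c) = decSum f w := by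
  classical
  rw [decSum, ← List.sum_toFinset f (nodup_decompositions w)]
  refine Finset.sum_bij (fun c _ => w.splitWrtComposition c) ?_ ?_ ?_ ?_
  · intro c _
    simp only [List.mem_toFinset, mem_decompositions]
    refine ⟨List.flatten_splitWrtComposition w c, fun h => ?_⟩
    simpa using List.length_pos_of_mem_splitWrtComposition h
  · intro c _ c' _ h
    refine Composition.ext ?_
    rw [← List.map_length_splitWrtComposition w c, h, List.map_length_splitWrtComposition]
  · intro L hL
    simp only [List.mem_toFinset, mem_decompositions] at hL
    obtain ⟨rfl, hL⟩ := hL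
    refine ⟨⟨L.map List.length, ?_, ?_⟩, Finset.mem_univ _, ?_⟩
    · intro i hi
      obtain ⟨l, hl, rfl⟩ := List.mem_map.1 hi
      exact List.length_pos_iff.2 fun h => hL (h ▸ hl)
    · simp [List.length_flatten]
    · exact List.splitWrtComposition_flatten _ _ rfl
  · intro c _
    rfl

end WordSums

namespace QSh

section Coproduct

variable {Ω : Type*}

/-- The additive extension of a function on words. -/
noncomputable def intLift {M : Type*} [AddCommGroup M] (f : List Ω → M) : QSh ℤ Ω →+ M :=
  addLift fun w => zmultiplesHom M (f w)

@[simp] lemma intLift_of {M : Type*} [AddCommGroup M] (f : List Ω → M) (w : List Ω) :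
    intLift f (of w) = f w :=
  (Finsupp.liftAddHom_apply_single _ w 1).trans (one_zsmul _)

variable [AddCommSemigroup Ω]

/-- The weight of a word in the semigroup with a zero adjoined. -/
def weight (w : List Ω) : WithZero Ω := (w.map (fun a : Ω => (a : WithZero Ω))).sum

lemma weight_cons_eq_wt [Inhabited Ω] (a : Ω) (w : List Ω) :
    weight (a :: w) = ((wt (a :: w) : Ω) : WithZero Ω) := by
  induction w generalizing a with
  | nil => simp [weight, wt]
  | cons b w ih =>
    have h := ih (a + b)
    simp only [weight, wt, List.map_cons, List.sum_cons, List.foldl_cons, WithZero.coe_add] at h ⊢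
    rw [← h, add_assoc]

/-- The additive map applying `f s` on the span of the words of weight `s`. -/
noncomputable def byWeight {M : Type*} [AddCommGroup M] (f : WithZero Ω → QSh ℤ Ω →+ M) :
    QSh ℤ Ω →+ M :=
  intLift fun w => f (weight w) (of w)

lemma byWeight_cons {M : Type*} [AddCommGroup M] (f : WithZero Ω → QSh ℤ Ω →+ M) (a : Ω)
    (x : QSh ℤ Ω) :
    byWeight f (cons a x) = byWeight (fun s => (f ((a : WithZero Ω) + s)).comp (cons a).toAddMonoidHom) x := by
  refine DFunLike.congr_fun (int_addHom_ext (f := (byWeight f).comp (cons a).toAddMonoidHom)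
    fun w => ?_) x
  simp [byWeight, weight]

lemma byWeight_of_mul_of {M : Type*} [AddCommGroup M] (f : WithZero Ω → QSh ℤ Ω →+ M)
    (u v : List Ω) :
    byWeight f (of u * of v) = f (weight u + weight v) (of u * of v) := by
  induction u generalizing f v with
  | nil => simp [← one_def, byWeight, weight]
  | cons a u ihu =>
    induction v generalizing f with
    | nil => simp [← one_def, byWeight, weight]
    | cons b v ihv =>
      have h₁ := ihu (fun s => (f (a + s)).comp (cons a).toAddMonoidHom) (b :: v)
      have h₂ := ihv (fun s => (f (b + s)).comp (cons b).toAddMonoidHom)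
      have h₃ := ihu (fun s => (f ((a + b : Ω) + s)).comp (cons (a + b)).toAddMonoidHom) v
      have e₁ : (a : WithZero Ω) + (weight u + weight (b :: v)) =
        weight (a :: u) + weight (b :: v) := by simp [weight, add_assoc]
      have e₂ : (b : WithZero Ω) + (weight (a :: u) + weight v) =
        weight (a :: u) + weight (b :: v) := by simp [weight, add_left_comm]
      have e₃ : ((a + b : Ω) : WithZero Ω) + (weight u + weight v) =
        weight (a :: u) + weight (b :: v) := by simp [weight, add_assoc, add_left_comm]
      simp only [AddMonoidHom.comp_apply, e₁, e₂, e₃] at h₁ h₂ h₃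
      rw [← cons_of a, ← cons_of b, cons_mul_cons, cons_of, cons_of, map_add, map_add,
        byWeight_cons, byWeight_cons, byWeight_cons, h₁, h₂, h₃, ← map_add, ← map_add]
      rfl

/-- The deconcatenation coproduct, with right tensor factors as coefficients. -/
noncomputable def deconc : QSh ℤ Ω →+ QSh (QSh ℤ Ω) Ω :=
  intLift (splitSum fun u v => (of v : QSh ℤ Ω) • (of u : QSh (QSh ℤ Ω) Ω))

lemma deconc_of_nil : deconc (of [] : QSh ℤ Ω) = 1 := by
  rw [deconc, intLift_of, splitSum_nil, ← one_def, ← one_def, one_smul]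

lemma deconc_of_cons (a : Ω) (w : List Ω) :
    deconc (of (a :: w)) = (of (a :: w) : QSh ℤ Ω) • (1 : QSh (QSh ℤ Ω) Ω) +
      splitSum (fun u v => (of v : QSh ℤ Ω) • (of (a :: u) : QSh (QSh ℤ Ω) Ω)) w := by
  rw [deconc, intLift_of, splitSum_cons, ← one_def]

lemma deconc_cons (a : Ω) (x : QSh ℤ Ω) :
    deconc (cons a x) = cons a x • (1 : QSh (QSh ℤ Ω) Ω) + cons a (deconc x) := by
  refine DFunLike.congr_fun (int_addHom_ext (f := deconc.comp (cons a).toAddMonoidHom)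
    (g := ((LinearMap.toSpanSingleton (QSh ℤ Ω) (QSh (QSh ℤ Ω) Ω) 1).toAddMonoidHom.comp
        (cons a).toAddMonoidHom) +
      (cons a).toAddMonoidHom.comp deconc) fun w => ?_) x
  have h := map_splitSum (cons (R := QSh ℤ Ω) a).toAddMonoidHom
    (fun u v => (of v : QSh ℤ Ω) • (of u : QSh (QSh ℤ Ω) Ω)) w
  simp only [LinearMap.toAddMonoidHom_coe, map_smul, cons_of] at h
  simp only [AddMonoidHom.comp_apply, AddMonoidHom.add_apply, LinearMap.toAddMonoidHom_coe,
    cons_of, LinearMap.toSpanSingleton_apply, deconc_of_cons]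
  rw [deconc, intLift_of, h]

lemma scalar_add_cons_mul {R : Type*} [CommRing R] (r s : R) (a b : Ω) (x y : QSh R Ω) :
    (r • 1 + cons a x) * (s • 1 + cons b y) = (r * s) • 1 + cons a (x * (s • 1 + cons b y)) +
      cons b ((r • 1 + cons a x) * y) + cons (a + b) (x * y) := by
  simp only [mul_add, add_mul, cons_mul_cons, map_add, smul_mul_assoc, mul_smul_comm, one_mul,
    mul_one, map_smul, smul_add, smul_smul, mul_comm s r]
  abel

lemma deconc_of_mul_of (u v : List Ω) :
    deconc (of u * of v : QSh ℤ Ω) = deconc (of u) * deconc (of v) := by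
  induction u generalizing v with
  | nil => rw [deconc_of_nil, ← one_def, one_mul, one_mul]
  | cons a u ihu =>
    induction v with
    | nil => rw [deconc_of_nil, ← one_def, mul_one, mul_one]
    | cons b v ihv =>
      have e : (of (a :: u) * of (b :: v) : QSh ℤ Ω) = cons a (of u * of (b :: v)) +
          cons b (of (a :: u) * of v) + cons (a + b) (of u * of v) := by
        rw [← cons_of a u, ← cons_of b v, cons_mul_cons]
      have ea := deconc_cons a (of u)
      have eb := deconc_cons b (of v)
      rw [cons_of] at ea eb
      rw [e, map_add, map_add, deconc_cons, deconc_cons, deconc_cons, ihu, ihu, ihv, ea, eb]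
      rw [scalar_add_cons_mul, e, add_smul, add_smul]
      abel

end Coproduct

end QSh

namespace QSh

section Gamma

variable {R Ω : Type*} [CommRing R]

/-- `cons` extended by zero to the adjoined zero weight. -/
noncomputable def consWeight (s : WithZero Ω) : QSh R Ω →+ QSh R Ω :=
  WithZero.recZeroCoe 0 (fun a => (cons a).toAddMonoidHom) s

@[simp] lemma consWeight_zero : consWeight (R := R) (0 : WithZero Ω) = 0 := rfl

@[simp] lemma consWeight_coe (a : Ω) (x : QSh R Ω) : consWeight (a : WithZero Ω) x = cons a x := rfl

variable [AddCommSemigroup Ω] [Inhabited Ω]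

/-- The decomposition sum `∑ φ(w¹)⋯φ(wˢ) • ‖w¹‖⋯‖wˢ‖` of a word. -/
noncomputable def gammaWord (φ : QSh ℤ Ω →+* R) (w : List Ω) : QSh R Ω :=
  decSum (fun L => (L.map fun u => φ (of u)).prod • of (L.map wt)) w

lemma gammaWord_nil (φ : QSh ℤ Ω →+* R) : gammaWord φ [] = 1 := by
  simp [gammaWord, decSum_nil, one_def]

lemma gammaWord_cons (φ : QSh ℤ Ω →+* R) (a : Ω) (w : List Ω) :
    gammaWord φ (a :: w) =
      splitSum (fun u v => cons (wt (a :: u)) (φ (of (a :: u)) • gammaWord φ v)) w := by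
  rw [gammaWord, decSum_cons_eq_splitSum]
  congr 1
  funext u v
  have h := map_decSum ((cons (R := R) (wt (a :: u))).toAddMonoidHom.comp
      (DistribSMul.toAddMonoidHom (QSh R Ω) (φ (of (a :: u)))))
    (fun L => (L.map fun u => φ (of u)).prod • of (L.map wt)) v
  simp only [AddMonoidHom.comp_apply, DistribSMul.toAddMonoidHom_apply,
    LinearMap.toAddMonoidHom_coe, map_smul, smul_smul, cons_of] at h
  rw [gammaWord, map_smul]
  simpa only [map_smul, List.map_cons, List.prod_cons] using h.symm

/-- The additive extension of `gammaWord`. -/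
noncomputable def gamma (φ : QSh ℤ Ω →+* R) : QSh ℤ Ω →+ QSh R Ω :=
  intLift (gammaWord φ)

@[simp] lemma gamma_of (φ : QSh ℤ Ω →+* R) (w : List Ω) : gamma φ (of w) = gammaWord φ w :=
  intLift_of _ _

/-- The map sending `y • u` to `‖u‖` prepended to `φ(u) • Γ(y)`, and to zero if `u` is empty. -/
noncomputable def firstBlock (φ : QSh ℤ Ω →+* R) : QSh (QSh ℤ Ω) Ω →+ QSh R Ω :=
  addLift fun p => (consWeight (weight p)).comp
    ((DistribSMul.toAddMonoidHom (QSh R Ω) (φ (of p))).comp (gamma φ))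

lemma firstBlock_smul_of (φ : QSh ℤ Ω →+* R) (y : QSh ℤ Ω) (p : List Ω) :
    firstBlock φ (y • of p) = consWeight (weight p) (φ (of p) • gamma φ y) :=
  addLift_smul_of _ _ _

lemma firstBlock_smul_one (φ : QSh ℤ Ω →+* R) (y : QSh ℤ Ω) : firstBlock φ (y • 1) = 0 := by
  rw [one_def, firstBlock_smul_of]
  simp [weight]

lemma firstBlock_smul_of_mul_of (φ : QSh ℤ Ω →+* R) (y : QSh ℤ Ω) (p q : List Ω) :
    firstBlock φ (y • (of p * of q)) =
      consWeight (weight p + weight q) ((φ (of p) * φ (of q)) • gamma φ y) := by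
  let f : WithZero Ω → QSh ℤ Ω →+ QSh R Ω := fun s =>
    (consWeight s).comp ((LinearMap.toSpanSingleton R (QSh R Ω) (gamma φ y)).toAddMonoidHom.comp
      φ.toAddMonoidHom)
  have h : ((firstBlock φ).comp (DistribSMul.toAddMonoidHom (QSh (QSh ℤ Ω) Ω) y)).comp
      (baseChangeRingHom (R := QSh ℤ Ω)).toAddMonoidHom = byWeight f := by
    refine int_addHom_ext fun w => ?_
    have hw : baseChangeRingHom (of w : QSh ℤ Ω) = (of w : QSh (QSh ℤ Ω) Ω) := baseChange_of w
    simp [byWeight, f, hw, firstBlock_smul_of]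
  have h' := DFunLike.congr_fun h (of p * of q)
  rw [byWeight_of_mul_of] at h'
  have hp : baseChangeRingHom (of p : QSh ℤ Ω) = (of p : QSh (QSh ℤ Ω) Ω) := baseChange_of p
  have hq : baseChangeRingHom (of q : QSh ℤ Ω) = (of q : QSh (QSh ℤ Ω) Ω) := baseChange_of q
  simpa [f, hp, hq] using h'

lemma firstBlock_deconc_cons (φ : QSh ℤ Ω →+* R) (a : Ω) (x : QSh ℤ Ω) :
    firstBlock φ (deconc (cons a x)) = gamma φ (cons a x) := by
  refine DFunLike.congr_fun (int_addHom_ext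
    (f := ((firstBlock φ).comp deconc).comp (cons a).toAddMonoidHom)
    (g := (gamma φ).comp (cons a).toAddMonoidHom) fun w => ?_) x
  simp only [AddMonoidHom.comp_apply, LinearMap.toAddMonoidHom_coe, cons_of, gamma_of,
    deconc_of_cons, map_add, firstBlock_smul_one, zero_add, map_splitSum, firstBlock_smul_of,
    weight_cons_eq_wt, consWeight_coe, gammaWord_cons]

lemma gamma_of_mul_of (φ : QSh ℤ Ω →+* R) (u v : List Ω) :
    gamma φ (of u * of v) = gamma φ (of u) * gamma φ (of v) := by
  induction hn : u.length + v.length using Nat.strong_induction_on generalizing u v with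
  | _ n ih =>
    subst hn
    obtain _ | ⟨a, u⟩ := u
    · rw [gamma_of φ [], gammaWord_nil, ← one_def, one_mul, one_mul]
    obtain _ | ⟨b, v⟩ := v
    · rw [gamma_of φ [], gammaWord_nil, ← one_def, mul_one, mul_one]
    have h : gamma φ (of (a :: u) * of (b :: v)) =
        firstBlock φ (deconc (of (a :: u)) * deconc (of (b :: v))) := by
      rw [← deconc_of_mul_of, ← cons_of a, ← cons_of b, cons_mul_cons]
      simp only [map_add, firstBlock_deconc_cons]
    have hl : ∀ i, gamma φ (of (b :: v) * of (u.drop i)) =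
        gammaWord φ (u.drop i) * gammaWord φ (b :: v) := fun i => by
      rw [mul_comm, ih _ _ _ _ rfl, gamma_of, gamma_of]
      simp only [List.length_drop, List.length_cons]
      omega
    have hr : ∀ j, gamma φ (of (v.drop j) * of (a :: u)) =
        gammaWord φ (a :: u) * gammaWord φ (v.drop j) := fun j => by
      rw [mul_comm, ih _ _ _ _ rfl, gamma_of, gamma_of]
      simp only [List.length_drop, List.length_cons]
      omega
    have hlr : ∀ i j, gamma φ (of (v.drop j) * of (u.drop i)) =
        gammaWord φ (u.drop i) * gammaWord φ (v.drop j) := fun i j => by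
      rw [mul_comm, ih _ _ _ _ rfl, gamma_of, gamma_of]
      simp only [List.length_drop, List.length_cons]
      omega
    have hu := gammaWord_cons φ a u
    have hv := gammaWord_cons φ b v
    unfold splitSum at hu hv
    rw [h, deconc_of_cons, deconc_of_cons, gamma_of, gamma_of]
    unfold splitSum
    have key : gammaWord φ (a :: u) * gammaWord φ (b :: v) =
        (∑ i ∈ Finset.range (u.length + 1), cons (wt (a :: u.take i))
          ((φ (of (a :: u.take i)) • gammaWord φ (u.drop i)) * gammaWord φ (b :: v))) +
        (∑ j ∈ Finset.range (v.length + 1), cons (wt (b :: v.take j))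
          (gammaWord φ (a :: u) * (φ (of (b :: v.take j)) • gammaWord φ (v.drop j)))) +
        ∑ i ∈ Finset.range (u.length + 1), ∑ j ∈ Finset.range (v.length + 1),
          cons (wt (a :: u.take i) + wt (b :: v.take j))
            ((φ (of (a :: u.take i)) • gammaWord φ (u.drop i)) *
              (φ (of (b :: v.take j)) • gammaWord φ (v.drop j))) := by
      conv_lhs => rw [hu, hv, Finset.sum_mul_sum]
      simp only [cons_mul_cons, Finset.sum_add_distrib]
      rw [Finset.sum_comm (s := Finset.range (u.length + 1)) (t := Finset.range (v.length + 1))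
        (f := fun i j => cons (wt (b :: v.take j)) _)]
      simp only [← map_sum, ← Finset.mul_sum, ← Finset.sum_mul, ← hu, ← hv]
    rw [key, add_mul, mul_add, mul_add, Finset.sum_mul_sum]
    simp only [Finset.mul_sum, Finset.smul_sum, map_add, map_sum, smul_mul_assoc, mul_smul_comm,
      one_mul, mul_one, smul_smul, firstBlock_smul_one, firstBlock_smul_of,
      firstBlock_smul_of_mul_of, weight_cons_eq_wt, ← WithZero.coe_add, consWeight_coe, hl, hr, hlr]
    rw [zero_add, ← add_assoc, add_comm (∑ j ∈ Finset.range (v.length + 1), _)]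
    simp only [mul_comm (φ (of (b :: _)))]

/-- `gamma φ` as a ring homomorphism. -/
noncomputable def gammaRingHom (φ : QSh ℤ Ω →+* R) : QSh ℤ Ω →+* QSh R Ω :=
  { gamma φ with
    map_one' := (gamma_of φ []).trans (gammaWord_nil φ)
    map_zero' := map_zero (gamma φ)
    map_mul' := by
      intro x y
      change gamma φ (x * y) = gamma φ x * gamma φ y
      suffices h : (gamma φ).comp (AddMonoidHom.mulLeft x) =
          (AddMonoidHom.mulLeft (gamma φ x)).comp (gamma φ) from DFunLike.congr_fun h y
      refine int_addHom_ext fun v => ?_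
      suffices h : (gamma φ).comp (AddMonoidHom.mulRight (of v)) =
          (AddMonoidHom.mulRight (gamma φ (of v))).comp (gamma φ) from DFunLike.congr_fun h x
      exact int_addHom_ext fun u => gamma_of_mul_of φ u v }

lemma gammaRingHom_of (φ : QSh ℤ Ω →+* R) (w : List Ω) :
    gammaRingHom φ (of w) = gammaWord φ w :=
  gamma_of φ w

end Gamma

end QSh

section WordSumsMap

lemma splitSum_map {α β M : Type*} [AddCommMonoid M] (F : List β → List β → M) (g : α → β)
    (w : List α) : splitSum F (w.map g) = splitSum (fun u v => F (u.map g) (v.map g)) w := by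
  simp [splitSum, List.map_take, List.map_drop]

lemma decSum_splitSum_cons {α M : Type*} [AddCommMonoid M]
    (F : List (List α) → List (List α) → M) (hF : ∀ L, F [] L = 0) (a : α) (w : List α) :
    decSum (splitSum F) (a :: w) =
      splitSum (fun u v => decSum (fun L => decSum (F L) v) (a :: u)) w := by
  rw [decSum_splitSum, splitSum_cons, decSum_nil, decSum_congr fun L _ _ => hF L]
  simp [decSum]

end WordSumsMap

namespace QSh

section Tensor

variable {Ω : Type*} [AddCommSemigroup Ω]

/-- The basis expansion of a tensor in `QSh (QSh ℤ Ω) Ω` whose left factor is a word. -/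
noncomputable def pairWith (p : List Ω) : QSh ℤ Ω →+ (List Ω × List Ω →₀ ℤ) :=
  Finsupp.mapDomain.addMonoidHom fun v => (p, v)

/-- Tensors of degree two as combinations of pairs of words. -/
noncomputable def toPairs : QSh (QSh ℤ Ω) Ω →+ (List Ω × List Ω →₀ ℤ) :=
  addLift pairWith

/-- Tensors of degree three as combinations of triples of words. -/
noncomputable def toTriples :
    QSh (QSh (QSh ℤ Ω) Ω) Ω →+ (List Ω × List Ω × List Ω →₀ ℤ) :=
  addLift fun p => (Finsupp.mapDomain.addMonoidHom fun r => (p, r)).comp toPairs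

lemma pairWith_of (p v : List Ω) : pairWith p (of v) = Finsupp.single (p, v) 1 :=
  Finsupp.mapDomain_single

lemma toPairs_smul_of (y : QSh ℤ Ω) (p : List Ω) : toPairs (y • of p) = pairWith p y :=
  addLift_smul_of _ _ _

lemma toTriples_smul_of (y : QSh (QSh ℤ Ω) Ω) (p : List Ω) :
    toTriples (y • of p) = Finsupp.mapDomain (fun r => (p, r)) (toPairs y) :=
  addLift_smul_of _ _ _

lemma sum_smul_qsh (u : List Ω) (x : QSh ℤ Ω) :
    (Finsupp.sum x fun v c => c • qsh u v) = of u * x := by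
  suffices h : Finsupp.liftAddHom (fun v => zmultiplesHom (QSh ℤ Ω) (shuffle u v)) =
      AddMonoidHom.mulLeft (of u : QSh ℤ Ω) from DFunLike.congr_fun h x
  refine int_addHom_ext fun v => ?_
  refine (Finsupp.liftAddHom_apply_single _ v 1).trans ?_
  rw [AddMonoidHom.coe_mulLeft, of_mul_of, baseChange_int]
  exact one_zsmul _

lemma qshFold_eq (L : List (List Ω)) :
    (qshFold L : List Ω →₀ ℤ) = ((L.map of).prod : QSh ℤ Ω) := by
  induction L with
  | nil => rfl
  | cons u L ih =>
    rw [qshFold, ih, List.map_cons, List.prod_cons]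
    exact sum_smul_qsh u _

lemma pair_addHom_ext {M : Type*} [AddCommGroup M] {f g : QSh (QSh ℤ Ω) Ω →+ M}
    (h : ∀ v p, f ((of v : QSh ℤ Ω) • of p) = g ((of v : QSh ℤ Ω) • of p)) : f = g := by
  refine addHom_ext fun y p => ?_
  let s := (LinearMap.toSpanSingleton (QSh ℤ Ω) (QSh (QSh ℤ Ω) Ω) (of p)).toAddMonoidHom
  exact DFunLike.congr_fun (int_addHom_ext (f := f.comp s) (g := g.comp s) fun v => h v p) y

lemma mapDomain_toPairs_smul_baseChange (q v : List Ω) (z : QSh ℤ Ω) :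
    Finsupp.mapDomain (fun r => (q, r)) (toPairs ((of v : QSh ℤ Ω) • baseChangeRingHom z)) =
      Finsupp.mapDomain (fun r : List Ω × List Ω => (r.1, r.2, v)) (pairWith q z) := by
  refine DFunLike.congr_fun (int_addHom_ext
    (f := (Finsupp.mapDomain.addMonoidHom fun r => (q, r)).comp (toPairs.comp
      ((DistribSMul.toAddMonoidHom (QSh (QSh ℤ Ω) Ω) (of v : QSh ℤ Ω)).comp
        (baseChangeRingHom : QSh ℤ Ω →+* QSh (QSh ℤ Ω) Ω).toAddMonoidHom)))
    (g := (Finsupp.mapDomain.addMonoidHom fun r : List Ω × List Ω => (r.1, r.2, v)).comp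
      (pairWith q)) fun t => ?_) z
  have ht : baseChangeRingHom (of t : QSh ℤ Ω) = (of t : QSh (QSh ℤ Ω) Ω) := baseChange_of t
  simp [ht, toPairs_smul_of, pairWith_of, Finsupp.mapDomain_single]

/-- A sum over the pairs of words of a tensor, as an additive map. -/
lemma sum_toPairs {M : Type*} [AddCommGroup M] (h : List Ω × List Ω → M)
    (f : QSh (QSh ℤ Ω) Ω →+ M) (hf : ∀ v p, f ((of v : QSh ℤ Ω) • of p) = h (p, v))
    (x : QSh (QSh ℤ Ω) Ω) : (toPairs x).sum (fun p c => c • h p) = f x := by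
  suffices e : (Finsupp.liftAddHom fun p => zmultiplesHom M (h p)).comp toPairs = f from
    DFunLike.congr_fun e x
  refine pair_addHom_ext fun v p => ?_
  rw [hf, AddMonoidHom.comp_apply, toPairs_smul_of, pairWith_of, Finsupp.liftAddHom_apply_single]
  simp

end Tensor

section Coassociativity

variable {Ω : Type*} [AddCommSemigroup Ω]

lemma weight_append (u v : List Ω) : weight (u ++ v) = weight u + weight v := by
  simp [weight]

variable [Inhabited Ω]

lemma weight_map_wt {L : List (List Ω)} (hL : [] ∉ L) : weight (L.map wt) = weight L.flatten := by
  induction L with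
  | nil => rfl
  | cons u L ih =>
    obtain _ | ⟨a, u⟩ := u
    · simp at hL
    · rw [List.flatten_cons, weight_append, ← ih (by simp_all), weight_cons_eq_wt a u]
      simp [weight]

lemma wt_map_wt {L : List (List Ω)} (hL : [] ∉ L) {a : Ω} {w : List Ω} (h : L.flatten = a :: w) :
    wt (L.map wt) = wt (a :: w) := by
  have hw := weight_map_wt hL
  obtain _ | ⟨u, L⟩ := L
  · simp at h
  rw [h, List.map_cons, weight_cons_eq_wt, weight_cons_eq_wt] at hw
  exact WithZero.coe_injective hw

/-- The coproduct `Γ` applied to the left tensor factor. -/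
noncomputable def gammaLeft : QSh (QSh ℤ Ω) Ω →+ QSh (QSh (QSh ℤ Ω) Ω) Ω :=
  addLift fun p =>
    (LinearMap.toSpanSingleton (QSh (QSh ℤ Ω) Ω) (QSh (QSh (QSh ℤ Ω) Ω) Ω)
      (gammaWord baseChangeRingHom p)).toAddMonoidHom.comp
    (algebraMap (QSh ℤ Ω) (QSh (QSh ℤ Ω) Ω) : QSh ℤ Ω →+ QSh (QSh ℤ Ω) Ω)

lemma gammaLeft_smul_of (y : QSh ℤ Ω) (p : List Ω) :
    gammaLeft (y • of p) =
      algebraMap (QSh ℤ Ω) (QSh (QSh ℤ Ω) Ω) y • gammaWord baseChangeRingHom p :=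
  addLift_smul_of _ _ _

/-- The coproduct `Γ` applied to the right tensor factor. -/
noncomputable def gammaRight : QSh (QSh ℤ Ω) Ω →+ QSh (QSh (QSh ℤ Ω) Ω) Ω :=
  addLift fun p =>
    (LinearMap.toSpanSingleton (QSh (QSh ℤ Ω) Ω) (QSh (QSh (QSh ℤ Ω) Ω) Ω)
      (of p)).toAddMonoidHom.comp (gamma (RingHom.id (QSh ℤ Ω)))

lemma gammaRight_smul_of (y : QSh ℤ Ω) (p : List Ω) :
    gammaRight (y • of p) = gamma (RingHom.id (QSh ℤ Ω)) y • of p :=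
  addLift_smul_of _ _ _

lemma gammaRight_gammaWord (w : List Ω) :
    gammaRight (gammaWord (RingHom.id (QSh ℤ Ω)) w) =
      gammaWord (gammaRingHom (RingHom.id (QSh ℤ Ω))) w := by
  rw [gammaWord, map_decSum, gammaWord]
  congr 1
  funext L
  rw [gammaRight_smul_of]
  congr 1
  exact (map_list_prod (gammaRingHom (RingHom.id (QSh ℤ Ω))) _).trans (by simp [Function.comp_def])

lemma gammaLeft_gammaWord (w : List Ω) :
    gammaLeft (gammaWord (RingHom.id (QSh ℤ Ω)) w) =
      gammaWord (gammaRingHom (RingHom.id (QSh ℤ Ω))) w := by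
  let b (L : List (List Ω)) : QSh (QSh (QSh ℤ Ω) Ω) Ω :=
    algebraMap (QSh ℤ Ω) (QSh (QSh ℤ Ω) Ω) (L.map of).prod •
      gammaWord baseChangeRingHom (L.map wt)
  have hb (w : List Ω) : gammaLeft (gammaWord (RingHom.id (QSh ℤ Ω)) w) = decSum b w := by
    rw [gammaWord, map_decSum]
    congr 1
    funext L
    exact gammaLeft_smul_of _ _
  let K (L₁ L₂ : List (List Ω)) : QSh (QSh (QSh ℤ Ω) Ω) Ω :=
    if L₁ = [] then 0 else cons (wt (L₁.map wt))
      (((L₁.map (of : List Ω → QSh ℤ Ω)).prod • (of (L₁.map wt) : QSh (QSh ℤ Ω) Ω)) • b L₂)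
  have hK (u : List Ω) (L : List (List Ω)) : b (u :: L) = splitSum K (u :: L) := by
    rw [splitSum_cons]
    simp only [b, K, List.map_cons, gammaWord_cons, splitSum_map, if_true, zero_add,
      List.cons_ne_nil, if_false]
    unfold splitSum
    rw [Finset.smul_sum]
    refine Finset.sum_congr rfl fun i _ => ?_
    have hL : (L.map (of : List Ω → QSh ℤ Ω)).prod =
        ((L.take i).map of).prod * ((L.drop i).map of).prod := by
      rw [← List.prod_append, ← List.map_append, List.take_append_drop]
    have hw (p : List Ω) : baseChangeRingHom (of p : QSh ℤ Ω) = (of p : QSh (QSh ℤ Ω) Ω) :=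
      baseChange_of p
    beta_reduce
    rw [← map_smul, smul_smul, smul_smul, hw]
    congr 2
    simp only [List.prod_cons, hL, Algebra.smul_def, map_mul]
    ring
  induction hn : w.length using Nat.strong_induction_on generalizing w with
  | _ n ih =>
    subst hn
    rw [hb]
    obtain _ | ⟨a, w⟩ := w
    · simp [decSum_nil, b, gammaWord_nil]
    · rw [decSum_congr (g := splitSum K) fun L _ hL => ?_,
        decSum_splitSum_cons K (fun L => if_pos rfl), gammaWord_cons]
      · refine Finset.sum_congr rfl fun i _ => ?_
        beta_reduce
        rw [gammaRingHom_of, ← ih _ _ _ rfl, hb]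
        · generalize w.take i = u
          generalize w.drop i = v
          let h : QSh (QSh ℤ Ω) Ω →+ QSh (QSh (QSh ℤ Ω) Ω) Ω :=
            (cons (wt (a :: u))).toAddMonoidHom.comp
              (LinearMap.toSpanSingleton _ _ (decSum b v)).toAddMonoidHom
          refine Eq.trans ?_ (map_decSum h _ (a :: u)).symm
          refine decSum_congr fun L₁ hL₁ hu => ?_
          obtain _ | ⟨u₁, L₁⟩ := L₁
          · simp at hu
          let g : QSh (QSh (QSh ℤ Ω) Ω) Ω →+ QSh (QSh (QSh ℤ Ω) Ω) Ω :=
            (cons (wt (a :: u))).toAddMonoidHom.comp (DistribSMul.toAddMonoidHom _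
              ((((u₁ :: L₁).map (of : List Ω → QSh ℤ Ω)).prod •
                (of ((u₁ :: L₁).map wt) : QSh (QSh ℤ Ω) Ω))))
          refine Eq.trans ?_ (map_decSum g b v).symm
          simp only [K, g, if_neg (List.cons_ne_nil u₁ L₁), wt_map_wt hL₁ hu]
          rfl
        · simp only [List.length_drop, List.length_cons]
          omega
      · obtain _ | ⟨u, L⟩ := L
        · simp at hL
        · exact hK u L

lemma Gam_eq (w : List Ω) : Gam w = toPairs (gammaWord (RingHom.id (QSh ℤ Ω)) w) := by
  rw [Gam, sum_composition (fun L => Finsupp.mapDomain (fun v => (L.map wt, v)) (qshFold L)),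
    gammaWord, map_decSum]
  congr 1
  funext L
  rw [toPairs_smul_of, qshFold_eq]
  rfl

lemma toTriples_gammaLeft (v p : List Ω) :
    toTriples (gammaLeft ((of v : QSh ℤ Ω) • of p)) =
      Finsupp.mapDomain (fun r : List Ω × List Ω => (r.1, r.2, v)) (Gam p) := by
  rw [gammaLeft_smul_of, Gam_eq, gammaWord, gammaWord]
  let f : QSh (QSh (QSh ℤ Ω) Ω) Ω →+ (List Ω × List Ω × List Ω →₀ ℤ) :=
    toTriples.comp (DistribSMul.toAddMonoidHom _
      (algebraMap (QSh ℤ Ω) (QSh (QSh ℤ Ω) Ω) (of v)))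
  let g : QSh (QSh ℤ Ω) Ω →+ (List Ω × List Ω × List Ω →₀ ℤ) :=
    (Finsupp.mapDomain.addMonoidHom fun r : List Ω × List Ω => (r.1, r.2, v)).comp toPairs
  refine (map_decSum f _ _).trans (Eq.trans ?_ (map_decSum g _ _).symm)
  congr 1
  funext L
  have h : (L.map fun u => baseChangeRingHom (of u : QSh ℤ Ω)).prod =
      (baseChangeRingHom (L.map of).prod : QSh (QSh ℤ Ω) Ω) := by
    rw [map_list_prod, List.map_map]; rfl
  simp only [f, g, AddMonoidHom.comp_apply, DistribSMul.toAddMonoidHom_apply, smul_smul, h,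
    toTriples_smul_of, ← Algebra.smul_def, toPairs_smul_of]
  exact mapDomain_toPairs_smul_baseChange _ _ _

lemma toTriples_gammaRight (v p : List Ω) :
    toTriples (gammaRight ((of v : QSh ℤ Ω) • of p)) =
      Finsupp.mapDomain (fun r : List Ω × List Ω => (p, r.1, r.2)) (Gam v) := by
  rw [gammaRight_smul_of, toTriples_smul_of, gamma_of, Gam_eq]

end Coassociativity

end QSh

/-- the decomposition coproduct `Γ` is coassociative:
`(Γ ⊗ Id) ∘ Γ = (Id ⊗ Γ) ∘ Γ`. -/
theorem Gam_coassoc {Ω : Type*} [AddCommSemigroup Ω] [Inhabited Ω] (w : List Ω) :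
    (Gam w).sum (fun p c => c •
        Finsupp.mapDomain (fun r : List Ω × List Ω => (r.1, r.2, p.2)) (Gam p.1)) =
    (Gam w).sum (fun p c => c •
        Finsupp.mapDomain (fun r : List Ω × List Ω => (p.1, r.1, r.2)) (Gam p.2)) := by
  rw [QSh.Gam_eq w,
    QSh.sum_toPairs (fun p => Finsupp.mapDomain (fun r => (r.1, r.2, p.2)) (Gam p.1))
      (QSh.toTriples.comp QSh.gammaLeft) QSh.toTriples_gammaLeft,
    QSh.sum_toPairs (fun p => Finsupp.mapDomain (fun r => (p.1, r.1, r.2)) (Gam p.2))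
      (QSh.toTriples.comp QSh.gammaRight) QSh.toTriples_gammaRight,
    AddMonoidHom.comp_apply, AddMonoidHom.comp_apply, QSh.gammaLeft_gammaWord,
    QSh.gammaRight_gammaWord]
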